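/- arXiv:math/9903132 — 2 statements merged into one kernel-verified Lean document; each statement's English description precedes it below -/
import Mathlib

section
/- For each q with 0 ≤ q ≤ n−ℓ, the family of elements a_{I,J}, indexed by subsets J = {j₁ < ⋯ < j_q} ⊆ {ℓ+1,…,n} of cardinality q and tuples I = (i₁,…,i_q) with 1 ≤ i_p < j_p for each p, is a ℂ-basis of A^q; moreover, the union of these families over all 0 ≤ q ≤ n−ℓ is a ℂ-basis of A. -/
namespace OSDisc

/-- Hyperplane index set: pairs (i,j) with 1 ≤ i < j, ℓ+1 ≤ j ≤ n. -/
def Idx (ℓ n : ℕ) : Type :=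
  {p : ℕ × ℕ // 1 ≤ p.1 ∧ p.1 < p.2 ∧ ℓ + 1 ≤ p.2 ∧ p.2 ≤ n}

/-- The exterior algebra E over ℂ on the vector space with basis e_{i,j}. -/
abbrev E (ℓ n : ℕ) : Type := ExteriorAlgebra ℂ (Idx ℓ n →₀ ℂ)

/-- The generators e_{i,j} of E (junk value 0 for invalid indices). -/
noncomputable def gen (ℓ n : ℕ) (i j : ℕ) : E ℓ n :=
  if h : 1 ≤ i ∧ i < j ∧ ℓ + 1 ≤ j ∧ j ≤ n then
    ExteriorAlgebra.ι ℂ (Finsupp.single (⟨(i, j), h⟩ : Idx ℓ n) (1 : ℂ))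
  else 0

/-- Relations generating the Orlik-Solomon ideal. -/
def rel (ℓ n : ℕ) : E ℓ n → E ℓ n → Prop := fun x y =>
  y = 0 ∧
    ((∃ i j k, 1 ≤ i ∧ i < j ∧ j < k ∧ k ≤ n ∧ ℓ + 1 ≤ j ∧
        x = gen ℓ n i j * gen ℓ n i k - gen ℓ n i j * gen ℓ n j k
            + gen ℓ n i k * gen ℓ n j k) ∨
      (∃ i j k, 1 ≤ i ∧ i < j ∧ j ≤ ℓ ∧ ℓ < k ∧ k ≤ n ∧
        x = gen ℓ n i k * gen ℓ n j k))

/-- The Orlik-Solomon algebra A = E/I of the discriminantal arrangement A_{n,ℓ}. -/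
abbrev A (ℓ n : ℕ) : Type := RingQuot (rel ℓ n)

/-- The quotient map E → A. -/
noncomputable def projA (ℓ n : ℕ) : E ℓ n →ₐ[ℂ] A ℓ n := RingQuot.mkAlgHom ℂ (rel ℓ n)

/-- The generators a_{i,j} of A. -/
noncomputable def a (ℓ n : ℕ) (i j : ℕ) : A ℓ n := projA ℓ n (gen ℓ n i j)

/-- The degree-q component E^q of the exterior algebra. -/
noncomputable def Edeg (ℓ n : ℕ) (q : ℕ) : Submodule ℂ (E ℓ n) :=
  (LinearMap.range (ExteriorAlgebra.ι ℂ : (Idx ℓ n →₀ ℂ) →ₗ[ℂ] E ℓ n)) ^ q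

/-- A^q: the image in A of the degree-q component of E. -/
noncomputable def Adeg (ℓ n : ℕ) (q : ℕ) : Submodule ℂ (A ℓ n) :=
  (Edeg ℓ n q).map (projA ℓ n).toLinearMap

/-- The element a_{I,J}: the product of a_{f j, j} over j ∈ J in increasing order. -/
noncomputable def aIJ (ℓ n : ℕ) (J : Finset ℕ) (f : ℕ → ℕ) : A ℓ n :=
  ((J.sort (· ≤ ·)).map fun j => a ℓ n (f j) j).prod

/-- ω_λ ∈ A¹. -/
noncomputable def omega (ℓ n : ℕ) (lam : ℕ × ℕ → ℂ) : A ℓ n :=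
  ∑ j ∈ Finset.Icc (ℓ + 1) n, ∑ i ∈ Finset.Ico 1 j, lam (i, j) • a ℓ n i j

/-- ω_{k,λ} = Σ_{i=1}^{k−1} λ_{i,k}·a_{i,k}. -/
noncomputable def omegaK (ℓ n : ℕ) (lam : ℕ × ℕ → ℂ) (k : ℕ) : A ℓ n :=
  ∑ i ∈ Finset.Ico 1 k, lam (i, k) • a ℓ n i k



/-- Index data for the degree-q basis: pairs (J, f) with J ⊆ {ℓ+1,…,n}, |J| = q,
    and 1 ≤ f j < j for j ∈ J (f normalized to 0 off J). -/
def BIdxQ (ℓ n q : ℕ) : Type :=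
  {Jf : Finset ℕ × (ℕ → ℕ) //
    Jf.1 ⊆ Finset.Icc (ℓ + 1) n ∧ Jf.1.card = q ∧
    (∀ j ∈ Jf.1, 1 ≤ Jf.2 j ∧ Jf.2 j < j) ∧ (∀ j, j ∉ Jf.1 → Jf.2 j = 0)}

/-- Index data for the basis of all of A. -/
def BIdxAll (ℓ n : ℕ) : Type :=
  {Jf : Finset ℕ × (ℕ → ℕ) //
    Jf.1 ⊆ Finset.Icc (ℓ + 1) n ∧
    (∀ j ∈ Jf.1, 1 ≤ Jf.2 j ∧ Jf.2 j < j) ∧ (∀ j, j ∉ Jf.1 → Jf.2 j = 0)}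

/-- `(J, f)` is admissible of level `m`: `J ⊆ {ℓ+1,…,m}`, `1 ≤ f j < j` on `J`, and `f = 0`
off `J`. -/
def Admissible (ℓ m : ℕ) (J : Finset ℕ) (f : ℕ → ℕ) : Prop :=
  J ⊆ Finset.Icc (ℓ + 1) m ∧ (∀ j ∈ J, 1 ≤ f j ∧ f j < j) ∧ ∀ j, j ∉ J → f j = 0

/-- The ordered product of the elements `t (f j) j` over `j ∈ J`. -/
def orderedProd {M : Type*} [Monoid M] (t : ℕ → ℕ → M) (J : Finset ℕ) (f : ℕ → ℕ) : M :=
  ((J.sort (· ≤ ·)).map fun j => t (f j) j).prod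

theorem sort_insert_top {J : Finset ℕ} {k : ℕ} (h : ∀ j ∈ J, j < k) :
    (insert k J).sort (· ≤ ·) = J.sort (· ≤ ·) ++ [k] := by
  have hk : k ∉ J := fun hk => (h k hk).false
  refine List.Perm.eq_of_pairwise (le := (· ≤ ·)) (fun a b _ _ h₁ h₂ => le_antisymm h₁ h₂)
    (Finset.pairwise_sort _ _) ?_ ?_
  · rw [List.pairwise_append]
    refine ⟨Finset.pairwise_sort _ _, by simp, ?_⟩
    intro a ha b hb
    rw [Finset.mem_sort] at ha
    rw [List.mem_singleton] at hb
    exact hb ▸ (h a ha).le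
  · rw [List.perm_ext_iff_of_nodup (Finset.sort_nodup _ _)]
    · intro a
      simp [or_comm]
    · rw [List.nodup_append]
      refine ⟨Finset.sort_nodup _ _, by simp, ?_⟩
      intro a ha b hb
      rw [Finset.mem_sort] at ha
      rw [List.mem_singleton] at hb
      exact hb ▸ (h a ha).ne

theorem orderedProd_insert {M : Type*} [Monoid M] (t : ℕ → ℕ → M) {J : Finset ℕ} {k : ℕ}
    (h : ∀ j ∈ J, j < k) (f : ℕ → ℕ) (i : ℕ) :
    orderedProd t (insert k J) (Function.update f k i) = orderedProd t J f * t i k := by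
  have hmap : (J.sort (· ≤ ·)).map (fun j => t (Function.update f k i j) j) =
      (J.sort (· ≤ ·)).map fun j => t (f j) j := by
    refine List.map_congr_left fun j hj => ?_
    rw [Finset.mem_sort] at hj
    rw [Function.update_of_ne (h j hj).ne]
  simp [orderedProd, sort_insert_top h, hmap]

namespace Admissible

variable {ℓ m : ℕ} {J : Finset ℕ} {f : ℕ → ℕ}

theorem lt_succ (h : Admissible ℓ m J f) : ∀ j ∈ J, j < m + 1 := fun j hj => by
  have := Finset.mem_Icc.1 (h.1 hj)
  omega

theorem mono (h : Admissible ℓ m J f) : Admissible ℓ (m + 1) J f :=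
  ⟨h.1.trans (Finset.Icc_subset_Icc_right (Nat.le_succ m)), h.2⟩

theorem insert (h : Admissible ℓ m J f) (hm : ℓ ≤ m) {i : ℕ} (hi : 1 ≤ i) (him : i ≤ m) :
    Admissible ℓ (m + 1) (insert (m + 1) J) (Function.update f (m + 1) i) := by
  refine ⟨?_, ?_, ?_⟩
  · refine Finset.insert_subset (Finset.mem_Icc.2 ⟨by omega, le_rfl⟩) h.mono.1
  · intro j hj
    rcases Finset.mem_insert.1 hj with rfl | hj
    · rw [Function.update_self]
      omega
    · rw [Function.update_of_ne (h.lt_succ j hj).ne]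
      exact h.2.1 j hj
  · intro j hj
    rw [Finset.mem_insert, not_or] at hj
    rw [Function.update_of_ne hj.1]
    exact h.2.2 j hj.2

theorem cases_succ (h : Admissible ℓ (m + 1) J f) :
    Admissible ℓ m J f ∨ ∃ J' f' i, Admissible ℓ m J' f' ∧ 1 ≤ i ∧ i ≤ m ∧
      J = Insert.insert (m + 1) J' ∧ f = Function.update f' (m + 1) i ∧ J.card = J'.card + 1 := by
  obtain ⟨h₁, h₂, h₃⟩ := h
  by_cases hJ : m + 1 ∈ J
  · right
    refine ⟨J.erase (m + 1), Function.update f (m + 1) 0, f (m + 1), ⟨?_, ?_, ?_⟩, (h₂ _ hJ).1,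
      Nat.lt_succ_iff.1 (h₂ _ hJ).2, (Finset.insert_erase hJ).symm, by simp,
      (Finset.card_erase_add_one hJ).symm⟩
    · intro j hj
      rw [Finset.mem_erase] at hj
      have := Finset.mem_Icc.1 (h₁ hj.2)
      exact Finset.mem_Icc.2 ⟨this.1, by omega⟩
    · intro j hj
      rw [Finset.mem_erase] at hj
      rw [Function.update_of_ne hj.1]
      exact h₂ j hj.2
    · intro j hj
      by_cases hjm : j = m + 1
      · rw [hjm, Function.update_self]
      · rw [Function.update_of_ne hjm]
        exact h₃ j fun hj' => hj (Finset.mem_erase.2 ⟨hjm, hj'⟩)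
  · left
    refine ⟨fun j hj => ?_, h₂, h₃⟩
    have := Finset.mem_Icc.1 (h₁ hj)
    have hne : j ≠ m + 1 := fun e => hJ (e ▸ hj)
    exact Finset.mem_Icc.2 ⟨this.1, by omega⟩

theorem eq_empty (h : Admissible ℓ ℓ J f) : J = ∅ ∧ f = 0 := by
  have hJ : J = ∅ := Finset.subset_empty.1 (by simpa using h.1)
  exact ⟨hJ, funext fun j => h.2.2 j (by simp [hJ])⟩

theorem mem_iff (h : Admissible ℓ m J f) (j : ℕ) : j ∈ J ↔ f j ≠ 0 := by
  refine ⟨fun hj => ?_, fun hj => by_contra fun hj' => hj (h.2.2 j hj')⟩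
  have := h.2.1 j hj
  omega

end Admissible

/-! ### A faithful module -/

/-- Operators on a vector space satisfying the relations of the Orlik–Solomon algebra, together
with a vector `vac` whose translates under ordered products are detected by `coord`. -/
structure OSRep (ℓ n : ℕ) (V : Type) [AddCommGroup V] [Module ℂ V] where
  /-- the action of the generators -/
  T : ℕ → ℕ → Module.End ℂ V
  /-- the sign operator -/
  sgn : Module.End ℂ V
  /-- the image of `1` -/
  vac : V
  /-- the coordinates with respect to the ordered monomials -/
  coord : V →ₗ[ℂ] ((ℕ → ℕ) →₀ ℂ)
  symm : ∀ i j, T i j = T j i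
  anticomm : ∀ i j k l v, T i j (T k l v) + T k l (T i j v) = 0
  arnold : ∀ i j k v, T i j (T j k v) + T j k (T k i v) + T k i (T i j v) = 0
  eq_zero_of_lt : ∀ i j, n < i → T i j = 0
  eq_zero_of_le : ∀ i j, i ≤ ℓ → j ≤ ℓ → T i j = 0
  sgn_T : ∀ i j v, sgn (T i j v) + T i j (sgn v) = 0
  sgn_vac : sgn vac = vac
  coord_orderedProd : ∀ J f, Admissible ℓ n J f →
    coord (orderedProd T J f vac) = Finsupp.single f 1

/-- The one-dimensional module for `n = ℓ`. -/
noncomputable def OSRep.base (ℓ : ℕ) : OSRep ℓ ℓ ℂ where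
  T _ _ := 0
  sgn := 1
  vac := 1
  coord := Finsupp.lsingle 0
  symm _ _ := rfl
  anticomm := by simp
  arnold := by simp
  eq_zero_of_lt _ _ _ := rfl
  eq_zero_of_le _ _ _ _ := rfl
  sgn_T := by simp
  sgn_vac := rfl
  coord_orderedProd J f h := by
    obtain ⟨rfl, rfl⟩ := h.eq_empty
    simp [orderedProd]

section diag

variable {V : Type} [AddCommGroup V] [Module ℂ V]

/-- The inclusion of the summand of `1` in `V × (ℕ →₀ V)`. -/
noncomputable def inOne : V →ₗ[ℂ] V × (ℕ →₀ V) := LinearMap.inl ℂ V (ℕ →₀ V)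

/-- The inclusion of the summand of `a_{m,n+1}` in `V × (ℕ →₀ V)`. -/
noncomputable def inGen (m : ℕ) : V →ₗ[ℂ] V × (ℕ →₀ V) :=
  LinearMap.inr ℂ V (ℕ →₀ V) ∘ₗ Finsupp.lsingle m

theorem prod_finsupp_ext {W : Type} [AddCommGroup W] [Module ℂ W]
    {f g : V × (ℕ →₀ V) →ₗ[ℂ] W} (h₁ : ∀ v, f (inOne v) = g (inOne v))
    (h₂ : ∀ m v, f (inGen m v) = g (inGen m v)) : f = g :=
  LinearMap.prod_ext (LinearMap.ext h₁) (Finsupp.lhom_ext' fun m => LinearMap.ext (h₂ m))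

/-- The componentwise action of an endomorphism on `V × (ℕ →₀ V)`. -/
noncomputable def diag (f : Module.End ℂ V) : Module.End ℂ (V × (ℕ →₀ V)) :=
  LinearMap.prodMap f (Finsupp.mapRange.linearMap f)

@[simp] theorem diag_inOne (f : Module.End ℂ V) (v : V) : diag f (inOne v) = inOne (f v) := by
  simp [diag, inOne]

@[simp] theorem diag_inGen (f : Module.End ℂ V) (m : ℕ) (v : V) :
    diag f (inGen m v) = inGen m (f v) := by
  simp [diag, inGen]

theorem diag_zero : diag (0 : Module.End ℂ V) = 0 := prod_finsupp_ext (by simp) (by simp)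

theorem diag_list_prod (l : List ℕ) {s : ℕ → Module.End ℂ (V × (ℕ →₀ V))}
    {t : ℕ → Module.End ℂ V} (h : ∀ j ∈ l, s j = diag (t j)) :
    (l.map s).prod = diag (l.map t).prod := by
  induction l with
  | nil => exact prod_finsupp_ext (by simp) (by simp)
  | cons j l ih =>
    rw [List.map_cons, List.map_cons, List.prod_cons, List.prod_cons, h j (by simp),
      ih fun k hk => h k (List.mem_cons_of_mem _ hk)]
    exact prod_finsupp_ext (by simp) (by simp)

end diag

namespace OSRep

variable {ℓ n : ℕ} {V : Type} [AddCommGroup V] [Module ℂ V] (R : OSRep ℓ n V)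

/-- The action of the new generator `a_{k,n+1}`. -/
noncomputable def newOp (k : ℕ) : Module.End ℂ (V × (ℕ →₀ V)) :=
  LinearMap.coprod (inGen k ∘ₗ R.sgn)
    (Finsupp.lsum ℂ fun m => (inGen m - inGen k) ∘ₗ R.T k m)

@[simp] theorem newOp_inOne (k : ℕ) (v : V) : R.newOp k (inOne v) = inGen k (R.sgn v) := by
  simp [newOp, inOne]

@[simp] theorem newOp_inGen (k m : ℕ) (v : V) :
    R.newOp k (inGen m v) = inGen m (R.T k m v) - inGen k (R.T k m v) := by
  simp [newOp, inGen]

/-- The sign operator on `V × (ℕ →₀ V)`. -/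
noncomputable def sgnSucc : Module.End ℂ (V × (ℕ →₀ V)) :=
  LinearMap.prodMap R.sgn (-Finsupp.mapRange.linearMap R.sgn)

@[simp] theorem sgnSucc_inOne (v : V) : R.sgnSucc (inOne v) = inOne (R.sgn v) := by
  simp [sgnSucc, inOne]

@[simp] theorem sgnSucc_inGen (m : ℕ) (v : V) :
    R.sgnSucc (inGen m v) = -inGen m (R.sgn v) := by
  simp [sgnSucc, inGen]

theorem diag_anticomm (i j k l : ℕ) :
    diag (R.T i j) * diag (R.T k l) + diag (R.T k l) * diag (R.T i j) = 0 := by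
  refine prod_finsupp_ext (fun v => ?_) fun m v => ?_ <;> simp [← map_add, R.anticomm]

theorem diag_newOp_anticomm (i j k : ℕ) :
    diag (R.T i j) * R.newOp k + R.newOp k * diag (R.T i j) = 0 := by
  refine prod_finsupp_ext (fun v => ?_) fun m v => ?_
  · have h := congrArg (inGen k) (R.sgn_T i j v)
    simp only [map_add, map_zero] at h
    simp
    linear_combination (norm := module) h
  · have h (p : ℕ) := congrArg (inGen p) (R.anticomm i j k m v)
    simp only [map_add, map_zero] at h
    simp
    linear_combination (norm := module) h m - h k

theorem newOp_anticomm (k l : ℕ) : R.newOp k * R.newOp l + R.newOp l * R.newOp k = 0 := by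
  refine prod_finsupp_ext (fun v => ?_) fun m v => ?_
  · simp [R.symm l k]
  · have h := congrArg (inGen m) (R.anticomm k m l m v)
    have hk := congrArg (inGen k) (R.arnold k l m v)
    have hk' := congrArg (inGen k) (R.anticomm k m l m v)
    have hk'' := congrArg (inGen k) (R.anticomm k l k m v)
    have hl := congrArg (inGen l) (R.arnold l k m v)
    have hl' := congrArg (inGen l) (R.anticomm k m l m v)
    have hl'' := congrArg (inGen l) (R.anticomm k l l m v)
    simp only [map_add, map_zero, R.symm m, R.symm l k] at h hk hk' hk'' hl hl' hl''
    simp [R.symm l k]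
    linear_combination (norm := module) h + hk - hk' - hk'' + hl - hl' - hl''

theorem arnold_newOp (i j : ℕ) :
    diag (R.T i j) * R.newOp j + R.newOp j * R.newOp i + R.newOp i * diag (R.T i j) = 0 := by
  rw [eq_neg_of_add_eq_zero_right (R.diag_newOp_anticomm i j i)]
  refine prod_finsupp_ext (fun v => ?_) fun m v => ?_
  · simp [R.symm j i]
  · have h (p : ℕ) := congrArg (inGen p) (R.arnold i j m v)
    have h' (p : ℕ) := congrArg (inGen p) (R.anticomm i j i m v)
    simp only [map_add, map_zero, R.symm m] at h h'
    simp [R.symm j i]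
    linear_combination (norm := module) h m - h' m - h j + h' j

/-- The operators on `V × (ℕ →₀ V)`. -/
noncomputable def TSucc (i j : ℕ) : Module.End ℂ (V × (ℕ →₀ V)) :=
  if i ≤ n ∧ j ≤ n then diag (R.T i j)
  else if i ≤ n ∧ j = n + 1 then R.newOp i
  else if i = n + 1 ∧ j ≤ n then R.newOp j
  else 0

theorem TSucc_of_le {i j : ℕ} (hi : i ≤ n) (hj : j ≤ n) : R.TSucc i j = diag (R.T i j) :=
  if_pos ⟨hi, hj⟩

theorem TSucc_top {i : ℕ} (hi : i ≤ n) : R.TSucc i (n + 1) = R.newOp i := by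
  rw [TSucc, if_neg (by omega), if_pos ⟨hi, rfl⟩]

theorem TSucc_symm (i j : ℕ) : R.TSucc i j = R.TSucc j i := by
  unfold TSucc
  split_ifs <;> first | omega | rfl | rw [R.symm]

theorem TSucc_eq_zero {i j : ℕ} (h : n < i) (h' : i ≠ n + 1 ∨ n < j) : R.TSucc i j = 0 := by
  rw [TSucc, if_neg (by omega), if_neg (by omega), if_neg (by omega)]

theorem TSucc_cases (i j : ℕ) : R.TSucc i j = 0 ∨
    (i ≤ n ∧ j ≤ n ∧ R.TSucc i j = diag (R.T i j)) ∨ ∃ k, R.TSucc i j = R.newOp k := by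
  unfold TSucc
  split_ifs with h₁ h₂ h₃
  · exact Or.inr (Or.inl ⟨h₁.1, h₁.2, rfl⟩)
  · exact Or.inr (Or.inr ⟨i, rfl⟩)
  · exact Or.inr (Or.inr ⟨j, rfl⟩)
  · exact Or.inl rfl

theorem TSucc_anticomm (i j k l : ℕ) :
    R.TSucc i j * R.TSucc k l + R.TSucc k l * R.TSucc i j = 0 := by
  rcases R.TSucc_cases i j with h | ⟨-, -, h⟩ | ⟨p, h⟩
  · simp [h]
  all_goals
    rcases R.TSucc_cases k l with h' | ⟨-, -, h'⟩ | ⟨q, h'⟩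
    · simp [h']
    all_goals rw [h, h']
  · exact R.diag_anticomm i j k l
  · exact R.diag_newOp_anticomm i j q
  · rw [add_comm]
    exact R.diag_newOp_anticomm k l p
  · exact R.newOp_anticomm p q

theorem newOp_mul_self (k : ℕ) : R.newOp k * R.newOp k = 0 := by
  linear_combination (norm := module) (1 / 2 : ℂ) • R.newOp_anticomm k k

theorem TSucc_arnold_top (i j : ℕ) :
    R.TSucc i j * R.TSucc j (n + 1) + R.TSucc j (n + 1) * R.TSucc (n + 1) i +
      R.TSucc (n + 1) i * R.TSucc i j = 0 := by
  rw [R.TSucc_symm (n + 1) i]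
  by_cases hi : i ≤ n
  · by_cases hj : j ≤ n
    · rw [R.TSucc_of_le hi hj, R.TSucc_top hi, R.TSucc_top hj]
      exact R.arnold_newOp i j
    · rw [R.TSucc_eq_zero (i := j) (j := n + 1) (by omega) (by omega), R.TSucc_symm i j]
      by_cases hj' : j = n + 1
      · subst hj'
        simp [R.TSucc_symm (n + 1) i, R.TSucc_top hi, R.newOp_mul_self]
      · simp [R.TSucc_eq_zero (i := j) (j := i) (by omega) (by omega)]
  · rw [R.TSucc_eq_zero (i := i) (j := n + 1) (by omega) (by omega)]
    by_cases hj : j ≤ n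
    · by_cases hi' : i = n + 1
      · subst hi'
        simp [R.TSucc_symm (n + 1) j, R.TSucc_top hj, R.newOp_mul_self]
      · simp [R.TSucc_eq_zero (i := i) (j := j) (by omega) (by omega)]
    · simp [R.TSucc_eq_zero (i := j) (j := n + 1) (by omega) (by omega)]

theorem TSucc_arnold (i j k : ℕ) :
    R.TSucc i j * R.TSucc j k + R.TSucc j k * R.TSucc k i + R.TSucc k i * R.TSucc i j = 0 := by
  have key : ∀ i j k : ℕ, n < k → R.TSucc i j * R.TSucc j k + R.TSucc j k * R.TSucc k i +
      R.TSucc k i * R.TSucc i j = 0 := by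
    intro i j k hk
    by_cases hk' : k = n + 1
    · subst hk'
      exact R.TSucc_arnold_top i j
    · simp [R.TSucc_symm j k, R.TSucc_eq_zero (i := k) (j := i) hk (by omega),
        R.TSucc_eq_zero (i := k) (j := j) hk (by omega)]
  by_cases hk : n < k
  · exact key i j k hk
  by_cases hj : n < j
  · linear_combination (norm := module) key k i j hj
  by_cases hi : n < i
  · linear_combination (norm := module) key j k i hi
  rw [not_lt] at hi hj hk
  rw [R.TSucc_of_le hi hj, R.TSucc_of_le hj hk, R.TSucc_of_le hk hi]
  refine prod_finsupp_ext (fun v => ?_) fun m v => ?_ <;> simp [← map_add, R.arnold]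

/-- The coordinate map on `V × (ℕ →₀ V)`. -/
noncomputable def coordSucc : V × (ℕ →₀ V) →ₗ[ℂ] ((ℕ → ℕ) →₀ ℂ) :=
  LinearMap.coprod R.coord (Finsupp.lsum ℂ fun i =>
    Finsupp.lmapDomain ℂ ℂ (fun f => Function.update f (n + 1) i) ∘ₗ R.coord)

theorem orderedProd_TSucc {J : Finset ℕ} {f : ℕ → ℕ} (h : Admissible ℓ n J f) :
    orderedProd R.TSucc J f = diag (orderedProd R.T J f) := by
  refine diag_list_prod _ fun j hj => ?_
  rw [Finset.mem_sort] at hj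
  have h₁ := h.lt_succ j hj
  have h₂ := h.2.1 j hj
  exact R.TSucc_of_le (by omega) (by omega)

/-- The module for `n + 1` built from that for `n`. -/
noncomputable def succ (h : ℓ ≤ n) : OSRep ℓ (n + 1) (V × (ℕ →₀ V)) where
  T := R.TSucc
  sgn := R.sgnSucc
  vac := inOne R.vac
  coord := R.coordSucc
  symm := R.TSucc_symm
  anticomm i j k l v := LinearMap.congr_fun (R.TSucc_anticomm i j k l) v
  arnold i j k v := LinearMap.congr_fun (R.TSucc_arnold i j k) v
  eq_zero_of_lt i j hi := R.TSucc_eq_zero (by omega) (by omega)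
  eq_zero_of_le i j hi hj := by
    rw [R.TSucc_of_le (by omega) (by omega), R.eq_zero_of_le i j hi hj, diag_zero]
  sgn_T i j v := by
    suffices H : R.sgnSucc * R.TSucc i j + R.TSucc i j * R.sgnSucc = 0 from
      LinearMap.congr_fun H v
    rcases R.TSucc_cases i j with h | ⟨-, -, h⟩ | ⟨p, h⟩
    · simp [h]
    · rw [h]
      refine prod_finsupp_ext (fun v => ?_) fun m v => ?_
      · simp [← map_add, R.sgn_T]
      · simp [← map_add, ← neg_add, R.sgn_T]
    · rw [h]
      refine prod_finsupp_ext (fun v => ?_) fun m v => ?_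
      · simp
      · have e (q : ℕ) := congrArg (inGen q) (R.sgn_T p m v)
        simp only [map_add, map_zero] at e
        simp
        linear_combination (norm := module) e p - e m
  sgn_vac := by rw [R.sgnSucc_inOne, R.sgn_vac]
  coord_orderedProd J f hJ := by
    rcases hJ.cases_succ with hJ | ⟨J, f, i, hJ', -, hi, rfl, rfl, -⟩
    · rw [R.orderedProd_TSucc hJ, diag_inOne, ← R.coord_orderedProd J f hJ]
      simp [coordSucc, inOne]
    · rw [orderedProd_insert _ hJ'.lt_succ, R.orderedProd_TSucc hJ', R.TSucc_top hi,
        Module.End.mul_apply, newOp_inOne, diag_inGen, R.sgn_vac]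
      simp [coordSucc, inGen, R.coord_orderedProd J f hJ']

end OSRep

theorem exists_osRep {ℓ n : ℕ} (h : ℓ ≤ n) :
    ∃ (V : Type) (_ : AddCommGroup V) (_ : Module ℂ V), Nonempty (OSRep ℓ n V) := by
  induction n, h using Nat.le_induction with
  | base => exact ⟨ℂ, inferInstance, inferInstance, ⟨OSRep.base ℓ⟩⟩
  | succ n h ih =>
    obtain ⟨V, _, _, ⟨R⟩⟩ := ih
    exact ⟨V × (ℕ →₀ V), inferInstance, inferInstance, ⟨R.succ h⟩⟩

/-! ### Linear independence -/

namespace OSRep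

variable {ℓ n : ℕ} {V : Type} [AddCommGroup V] [Module ℂ V] (R : OSRep ℓ n V)

/-- The action of degree-one elements of the exterior algebra. -/
noncomputable def genAct : (Idx ℓ n →₀ ℂ) →ₗ[ℂ] Module.End ℂ V :=
  Finsupp.linearCombination ℂ fun p : Idx ℓ n => R.T p.1.1 p.1.2

theorem genAct_anticomm (x y : Idx ℓ n →₀ ℂ) :
    R.genAct x * R.genAct y + R.genAct y * R.genAct x = 0 := by
  induction x using Finsupp.induction_linear with
  | zero => simp
  | add x x' hx hx' =>
    rw [map_add, add_mul, mul_add]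
    linear_combination (norm := module) hx + hx'
  | single p c =>
    induction y using Finsupp.induction_linear with
    | zero => simp
    | add y y' hy hy' =>
      rw [map_add, add_mul, mul_add]
      linear_combination (norm := module) hy + hy'
    | single q d =>
      have h : R.T p.1.1 p.1.2 * R.T q.1.1 q.1.2 + R.T q.1.1 q.1.2 * R.T p.1.1 p.1.2 = 0 :=
        LinearMap.ext fun v => R.anticomm _ _ _ _ v
      simp only [genAct, Finsupp.linearCombination_single, smul_mul_smul_comm]
      linear_combination (norm := module) (c * d) • h

theorem genAct_mul_self (x : Idx ℓ n →₀ ℂ) : R.genAct x * R.genAct x = 0 := by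
  linear_combination (norm := module) (1 / 2 : ℂ) • R.genAct_anticomm x x

/-- The action of the exterior algebra. -/
noncomputable def extAct : E ℓ n →ₐ[ℂ] Module.End ℂ V :=
  ExteriorAlgebra.lift ℂ ⟨R.genAct, R.genAct_mul_self⟩

theorem extAct_gen {i j : ℕ} (hi : 1 ≤ i) (hij : i < j) (hj : ℓ + 1 ≤ j) (hjn : j ≤ n) :
    R.extAct (gen ℓ n i j) = R.T i j := by
  rw [gen, dif_pos ⟨hi, hij, hj, hjn⟩, extAct, ExteriorAlgebra.lift_ι_apply]
  exact (Finsupp.linearCombination_single ℂ _ _).trans (one_smul ℂ _)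

theorem extAct_rel ⦃x y : E ℓ n⦄ (h : rel ℓ n x y) : R.extAct x = R.extAct y := by
  obtain ⟨rfl, ⟨i, j, k, hi, hij, hjk, hk, hj, rfl⟩ | ⟨i, j, k, hi, hij, hj, hk, hkn, rfl⟩⟩ := h
  all_goals
    have h : R.T i j * R.T j k + R.T j k * R.T k i + R.T k i * R.T i j = 0 :=
      LinearMap.ext fun v => R.arnold i j k v
    rw [R.symm k i] at h
    have h₁ : R.T i j * R.T i k + R.T i k * R.T i j = 0 :=
      LinearMap.ext fun v => R.anticomm i j i k v
    have h₂ : R.T i k * R.T j k + R.T j k * R.T i k = 0 :=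
      LinearMap.ext fun v => R.anticomm i k j k v
  · simp only [map_add, map_sub, map_mul, map_zero]
    rw [R.extAct_gen hi hij hj (by omega), R.extAct_gen hi (hij.trans hjk) (by omega) hk,
      R.extAct_gen (by omega) hjk (by omega) hk]
    linear_combination (norm := module) h₁ + h₂ - h
  · simp only [map_mul, map_zero]
    rw [R.extAct_gen hi (by omega) (by omega) hkn, R.extAct_gen (by omega) (by omega) hk hkn]
    rw [R.eq_zero_of_le i j (by omega) hj, zero_mul, mul_zero] at h
    linear_combination (norm := module) h₂ - h

/-- The action of the Orlik–Solomon algebra. -/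
noncomputable def act : A ℓ n →ₐ[ℂ] Module.End ℂ V :=
  RingQuot.liftAlgHom ℂ ⟨R.extAct, R.extAct_rel⟩

theorem act_a {i j : ℕ} (hi : 1 ≤ i) (hij : i < j) (hj : ℓ + 1 ≤ j) (hjn : j ≤ n) :
    R.act (a ℓ n i j) = R.T i j := by
  rw [a, projA, act, RingQuot.liftAlgHom_mkAlgHom_apply, R.extAct_gen hi hij hj hjn]

theorem act_aIJ {J : Finset ℕ} {f : ℕ → ℕ} (h : Admissible ℓ n J f) :
    R.act (aIJ ℓ n J f) = orderedProd R.T J f := by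
  rw [aIJ, orderedProd, map_list_prod, List.map_map]
  refine congrArg List.prod (List.map_congr_left fun j hj => ?_)
  rw [Finset.mem_sort] at hj
  have h₁ := Finset.mem_Icc.1 (h.1 hj)
  have h₂ := h.2.1 j hj
  exact R.act_a h₂.1 h₂.2 h₁.1 h₁.2

end OSRep

theorem BIdxAll.admissible {ℓ n : ℕ} (x : BIdxAll ℓ n) : Admissible ℓ n x.1.1 x.1.2 := x.2

theorem BIdxAll.snd_injective (ℓ n : ℕ) :
    Function.Injective fun x : BIdxAll ℓ n => x.1.2 := by
  intro x y (hxy : x.1.2 = y.1.2)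
  refine Subtype.ext (Prod.ext (Finset.ext fun j => ?_) hxy)
  rw [x.admissible.mem_iff, y.admissible.mem_iff, hxy]

theorem linearIndependent_aIJ {ℓ n : ℕ} (h : ℓ ≤ n) :
    LinearIndependent ℂ fun x : BIdxAll ℓ n => aIJ ℓ n x.1.1 x.1.2 := by
  obtain ⟨V, _, _, ⟨R⟩⟩ := exists_osRep h
  refine LinearIndependent.of_comp
    (R.coord ∘ₗ LinearMap.applyₗ R.vac ∘ₗ R.act.toLinearMap) ?_
  have key : ((R.coord ∘ₗ LinearMap.applyₗ R.vac ∘ₗ R.act.toLinearMap) ∘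
      fun x : BIdxAll ℓ n => aIJ ℓ n x.1.1 x.1.2) =
      (fun f => Finsupp.single f (1 : ℂ)) ∘ fun x : BIdxAll ℓ n => x.1.2 := by
    funext x
    simp [R.act_aIJ x.admissible, R.coord_orderedProd _ _ x.admissible]
  rw [key]
  exact (Finsupp.linearIndependent_single_one ℂ (ℕ → ℕ)).comp _ (BIdxAll.snd_injective ℓ n)

/-! ### Spanning -/

section Relations

variable {ℓ n : ℕ}

theorem gen_anticomm (i j k l : ℕ) :
    gen ℓ n i j * gen ℓ n k l + gen ℓ n k l * gen ℓ n i j = 0 := by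
  unfold gen
  split_ifs <;> simp [ExteriorAlgebra.ι_add_mul_swap]

theorem a_anticomm (i j k l : ℕ) : a ℓ n i j * a ℓ n k l = -(a ℓ n k l * a ℓ n i j) := by
  refine eq_neg_of_add_eq_zero_left ?_
  simpa [a] using congrArg (projA ℓ n) (gen_anticomm (ℓ := ℓ) (n := n) i j k l)

theorem a_mul_self (i j : ℕ) : a ℓ n i j * a ℓ n i j = 0 := by
  linear_combination (norm := module) (1 / 2 : ℂ) • a_anticomm (ℓ := ℓ) (n := n) i j i j

theorem a_mul_a_of_le {i j k : ℕ} (hi : 1 ≤ i) (hij : i < j) (hj : j ≤ ℓ) (hk : ℓ < k)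
    (hkn : k ≤ n) : a ℓ n i k * a ℓ n j k = 0 := by
  have h := RingQuot.mkAlgHom_rel ℂ (s := rel ℓ n)
    ⟨rfl, Or.inr ⟨i, j, k, hi, hij, hj, hk, hkn, rfl⟩⟩
  simpa [a, projA] using h

theorem a_mul_a_of_lt {i j k : ℕ} (hi : 1 ≤ i) (hij : i < j) (hjk : j < k) (hkn : k ≤ n)
    (hj : ℓ < j) : a ℓ n i k * a ℓ n j k = a ℓ n i j * a ℓ n j k - a ℓ n i j * a ℓ n i k := by
  have h := RingQuot.mkAlgHom_rel ℂ (s := rel ℓ n)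
    ⟨rfl, Or.inl ⟨i, j, k, hi, hij, hjk, hkn, hj, rfl⟩⟩
  simp only [map_add, map_sub, map_mul, map_zero] at h
  unfold a projA
  linear_combination (norm := module) h

theorem exists_a_mul_a {i j k : ℕ} (hi : 1 ≤ i) (hj : 1 ≤ j) (hik : i < k) (hjk : j < k)
    (hk : ℓ < k) (hkn : k ≤ n) :
    a ℓ n i k * a ℓ n j k = 0 ∨ ∃ (s t : ℕ) (c : ℂ), 1 ≤ s ∧ s < t ∧ ℓ < t ∧ t < k ∧
      a ℓ n i k * a ℓ n j k = c • (a ℓ n s t * a ℓ n t k - a ℓ n s t * a ℓ n s k) := by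
  rcases lt_trichotomy i j with h | rfl | h
  · by_cases hjl : j ≤ ℓ
    · exact Or.inl (a_mul_a_of_le hi h hjl hk hkn)
    · exact Or.inr ⟨i, j, 1, hi, h, not_le.1 hjl, hjk, by
        rw [one_smul, a_mul_a_of_lt hi h hjk hkn (not_le.1 hjl)]⟩
  · exact Or.inl (a_mul_self i k)
  · rw [a_anticomm i k j k]
    by_cases hil : i ≤ ℓ
    · exact Or.inl (by rw [a_mul_a_of_le hj h hil hk hkn, neg_zero])
    · exact Or.inr ⟨j, i, -1, hj, h, not_le.1 hil, hik, by
        rw [neg_one_smul, a_mul_a_of_lt hj h hik hkn (not_le.1 hil)]⟩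

end Relations

/-- The span of the monomials `a_{I,J}` with `J ⊆ {ℓ+1,…,m}` of cardinality `q`. -/
noncomputable def monoSpan (ℓ n m q : ℕ) : Submodule ℂ (A ℓ n) :=
  Submodule.span ℂ {x | ∃ J f, Admissible ℓ m J f ∧ J.card = q ∧ x = aIJ ℓ n J f}

section Spanning

variable {ℓ n m q : ℕ}

theorem monoSpan_le_succ : monoSpan ℓ n m q ≤ monoSpan ℓ n (m + 1) q := by
  refine Submodule.span_mono ?_
  rintro x ⟨J, f, h, hq, rfl⟩
  exact ⟨J, f, h.mono, hq, rfl⟩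

theorem mul_top_mem_monoSpan (hm : ℓ ≤ m) {i : ℕ} (hi : 1 ≤ i) (him : i ≤ m) {x : A ℓ n}
    (hx : x ∈ monoSpan ℓ n m q) : x * a ℓ n i (m + 1) ∈ monoSpan ℓ n (m + 1) (q + 1) := by
  suffices H : monoSpan ℓ n m q ≤
      (monoSpan ℓ n (m + 1) (q + 1)).comap (LinearMap.mulRight ℂ (a ℓ n i (m + 1))) from H hx
  refine Submodule.span_le.2 ?_
  rintro x ⟨J, f, h, hq, rfl⟩
  refine Submodule.subset_span ⟨insert (m + 1) J, Function.update f (m + 1) i,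
    h.insert hm hi him, ?_, (orderedProd_insert (a ℓ n) h.lt_succ f i).symm⟩
  rw [Finset.card_insert_of_notMem fun hJ => (h.lt_succ _ hJ).false, hq]

theorem mul_mem_monoSpan (hm : ℓ ≤ m) (hmn : m ≤ n) (q : ℕ) {x : A ℓ n}
    (hx : x ∈ monoSpan ℓ n m q) {i k : ℕ} (hi : 1 ≤ i) (hik : i < k) (hk : ℓ < k)
    (hkm : k ≤ m) : x * a ℓ n i k ∈ monoSpan ℓ n m (q + 1) := by
  induction m, hm using Nat.le_induction generalizing q x i k with
  | base => omega
  | succ m hm ih =>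
    suffices H : monoSpan ℓ n (m + 1) q ≤
        (monoSpan ℓ n (m + 1) (q + 1)).comap (LinearMap.mulRight ℂ (a ℓ n i k)) from H hx
    refine Submodule.span_le.2 ?_
    rintro x ⟨J, f, h, rfl, rfl⟩
    change aIJ ℓ n J f * a ℓ n i k ∈ monoSpan ℓ n (m + 1) (J.card + 1)
    rcases h.cases_succ with h' | ⟨J, f, r, h', hr, hrm, rfl, rfl, hcard⟩
    · have hx : aIJ ℓ n J f ∈ monoSpan ℓ n m J.card :=
        Submodule.subset_span ⟨J, f, h', rfl, rfl⟩
      by_cases hkm' : k ≤ m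
      · exact monoSpan_le_succ (ih (by omega) _ hx hi hik hk hkm')
      · obtain rfl : k = m + 1 := by omega
        exact mul_top_mem_monoSpan hm hi (by omega) hx
    · have hx : aIJ ℓ n J f ∈ monoSpan ℓ n m J.card :=
        Submodule.subset_span ⟨J, f, h', rfl, rfl⟩
      have hsplit : aIJ ℓ n (insert (m + 1) J) (Function.update f (m + 1) r) =
          aIJ ℓ n J f * a ℓ n r (m + 1) := orderedProd_insert (a ℓ n) h'.lt_succ f r
      rw [hcard, hsplit, mul_assoc]
      by_cases hkm' : k ≤ m
      · rw [a_anticomm, mul_neg, ← mul_assoc]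
        exact neg_mem (mul_top_mem_monoSpan hm hr hrm (ih (by omega) _ hx hi hik hk hkm'))
      · obtain rfl : k = m + 1 := by omega
        rcases exists_a_mul_a hr hi (by omega) hik hk hmn with h0 |
          ⟨s, t, c, hs, hst, ht, htm, h0⟩
        · rw [h0, mul_zero]
          exact zero_mem _
        · rw [h0, mul_smul_comm, mul_sub, ← mul_assoc, ← mul_assoc]
          have hy := ih (by omega) _ hx hs hst ht (by omega)
          exact Submodule.smul_mem _ _ (sub_mem
            (mul_top_mem_monoSpan hm (by omega) (by omega) hy)
            (mul_top_mem_monoSpan hm hs (by omega) hy))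

theorem mul_ι_mem_monoSpan (h : ℓ ≤ n) {x : A ℓ n} (hx : x ∈ monoSpan ℓ n n q)
    (v : Idx ℓ n →₀ ℂ) : x * projA ℓ n (ExteriorAlgebra.ι ℂ v) ∈ monoSpan ℓ n n (q + 1) := by
  induction v using Finsupp.induction_linear with
  | zero => simp
  | add v w hv hw =>
    rw [map_add, map_add, mul_add]
    exact add_mem hv hw
  | single p c =>
    have hp : projA ℓ n (ExteriorAlgebra.ι ℂ (Finsupp.single p c)) =
        c • a ℓ n p.1.1 p.1.2 := by
      rw [a, gen, dif_pos p.2, ← map_smul, ← map_smul]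
      exact congrArg (fun v => projA ℓ n (ExteriorAlgebra.ι ℂ v))
        (Finsupp.smul_single_one p c).symm
    rw [hp, mul_smul_comm]
    exact Submodule.smul_mem _ _
      (mul_mem_monoSpan h le_rfl q hx p.2.1 p.2.2.1 p.2.2.2.1 p.2.2.2.2)

theorem one_mem_monoSpan : (1 : A ℓ n) ∈ monoSpan ℓ n n 0 :=
  Submodule.subset_span ⟨∅, 0, by simp [Admissible], rfl, by simp [aIJ]⟩

theorem Adeg_zero : Adeg ℓ n 0 = 1 := by
  rw [Adeg, Edeg, Submodule.map_pow, pow_zero]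

theorem Adeg_succ : Adeg ℓ n (q + 1) = Adeg ℓ n q * Adeg ℓ n 1 := by
  simp only [Adeg, Edeg, Submodule.map_pow]
  rw [pow_succ, pow_one]

theorem a_mem_Adeg_one (i j : ℕ) : a ℓ n i j ∈ Adeg ℓ n 1 := by
  refine Submodule.mem_map_of_mem ?_
  rw [Edeg, pow_one, gen]
  split_ifs
  · exact LinearMap.mem_range_self _ _
  · exact zero_mem _

theorem list_prod_mem_Adeg (l : List ℕ) (f : ℕ → ℕ) :
    (l.map fun j => a ℓ n (f j) j).prod ∈ Adeg ℓ n l.length := by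
  induction l using List.reverseRecOn with
  | nil =>
    rw [List.map_nil, List.prod_nil, List.length_nil, Adeg_zero]
    exact Submodule.one_le.1 le_rfl
  | append_singleton l j ih =>
    rw [List.map_append, List.prod_append, List.length_append, List.length_singleton, Adeg_succ]
    refine Submodule.mul_mem_mul ih ?_
    simpa using a_mem_Adeg_one (f j) j

theorem monoSpan_eq_Adeg (h : ℓ ≤ n) (q : ℕ) : monoSpan ℓ n n q = Adeg ℓ n q := by
  refine le_antisymm (Submodule.span_le.2 ?_) ?_
  · rintro x ⟨J, f, -, rfl, rfl⟩
    rw [← Finset.length_sort (· ≤ ·)]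
    exact list_prod_mem_Adeg _ f
  · induction q with
    | zero =>
      rw [Adeg_zero]
      exact Submodule.one_le.2 one_mem_monoSpan
    | succ q ih =>
      rw [Adeg_succ, Submodule.mul_le]
      rintro x hx y ⟨e, he, rfl⟩
      rw [SetLike.mem_coe, Edeg, pow_one] at he
      obtain ⟨v, rfl⟩ := he
      exact mul_ι_mem_monoSpan h (ih hx) v

theorem iSup_monoSpan_eq_top (h : ℓ ≤ n) : ⨆ q, monoSpan ℓ n n q = ⊤ := by
  have key (e : E ℓ n) : ∀ x ∈ ⨆ q, monoSpan ℓ n n q,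
      x * projA ℓ n e ∈ ⨆ q, monoSpan ℓ n n q := by
    induction e using ExteriorAlgebra.induction with
    | algebraMap r =>
      intro x hx
      rw [AlgHom.commutes, ← Algebra.commutes, ← Algebra.smul_def]
      exact Submodule.smul_mem _ _ hx
    | ι v =>
      suffices H : ⨆ q, monoSpan ℓ n n q ≤ (⨆ q, monoSpan ℓ n n q).comap
          (LinearMap.mulRight ℂ (projA ℓ n (ExteriorAlgebra.ι ℂ v))) from fun x hx => H hx
      exact iSup_le fun q x hx =>
        Submodule.mem_iSup_of_mem (q + 1) (mul_ι_mem_monoSpan h hx v)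
    | mul e e' he he' =>
      intro x hx
      rw [map_mul, ← mul_assoc]
      exact he' _ (he x hx)
    | add e e' he he' =>
      intro x hx
      rw [map_add, mul_add]
      exact add_mem (he x hx) (he' x hx)
  refine eq_top_iff.2 fun x _ => ?_
  obtain ⟨e, rfl⟩ := RingQuot.mkAlgHom_surjective ℂ (rel ℓ n) x
  simpa [projA] using key e 1 (Submodule.mem_iSup_of_mem 0 one_mem_monoSpan)

end Spanning

/-- For each 0 ≤ q ≤ n−ℓ, the family a_{I,J} (|J| = q) is a ℂ-basis of A^q, and the
    union of these families over all q is a ℂ-basis of A. -/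
theorem statement0 (ℓ n : ℕ) (hℓ : 1 ≤ ℓ) (hn : ℓ < n) :
    (∀ q : ℕ, q ≤ n - ℓ →
      LinearIndependent ℂ (fun x : BIdxQ ℓ n q => aIJ ℓ n x.1.1 x.1.2) ∧
      Submodule.span ℂ (Set.range fun x : BIdxQ ℓ n q => aIJ ℓ n x.1.1 x.1.2)
        = Adeg ℓ n q) ∧
    LinearIndependent ℂ (fun x : BIdxAll ℓ n => aIJ ℓ n x.1.1 x.1.2) ∧
    Submodule.span ℂ (Set.range fun x : BIdxAll ℓ n => aIJ ℓ n x.1.1 x.1.2) = ⊤ := by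
  have hle := hn.le
  have hli := linearIndependent_aIJ hle
  refine ⟨fun q _ => ⟨?_, ?_⟩, hli, ?_⟩
  · refine hli.comp (fun x : BIdxQ ℓ n q => (⟨x.1, x.2.1, x.2.2.2⟩ : BIdxAll ℓ n)) ?_
    intro x y hxy
    exact Subtype.ext (congrArg (fun z : BIdxAll ℓ n => z.1) hxy)
  · rw [← monoSpan_eq_Adeg hle]
    refine congrArg (Submodule.span ℂ) (Set.ext fun x => ⟨?_, ?_⟩)
    · rintro ⟨⟨⟨J, f⟩, h₁, h₂, h₃⟩, rfl⟩
      exact ⟨J, f, ⟨h₁, h₃⟩, h₂, rfl⟩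
    · rintro ⟨J, f, ⟨h₁, h₃⟩, h₂, rfl⟩
      exact ⟨⟨(J, f), h₁, h₂, h₃⟩, rfl⟩
  · refine eq_top_iff.2 (iSup_monoSpan_eq_top hle ▸ iSup_le fun q => Submodule.span_mono ?_)
    rintro x ⟨J, f, h, -, rfl⟩
    exact ⟨⟨(J, f), h⟩, rfl⟩

end OSDisc
end

section
/- For each q with 0 ≤ q ≤ n−ℓ, dim_ℂ A^q = Σ_J ∏_{j∈J} (j−1), where the sum is over all subsets J ⊆ {ℓ+1,…,n} of cardinality q. -/
namespace OSDisc

/-- A family `X i j`, symmetric in its two indices, satisfying the defining relations of the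
Orlik–Solomon algebra of `A_{n,ℓ}`, extended by zero to all pairs of natural numbers. -/
structure IsArnold (ℓ n : ℕ) {R : Type*} [Ring R] (X : ℕ → ℕ → R) : Prop where
  symm : ∀ i j, X i j = X j i
  zero_right : ∀ i, X i 0 = 0
  high : ∀ i j, n < j → X i j = 0
  low : ∀ i j, i ≤ ℓ → j ≤ ℓ → X i j = 0
  diag : ∀ i, X i i = 0
  anticomm : ∀ i j k l, X i j * X k l = -(X k l * X i j)
  arnold : ∀ i j k, X i j * X j k + X j k * X k i + X k i * X i j = 0

/-- Indices of the monomial basis: for each `j ∈ {ℓ+1, …, ℓ+m}`, either no factor, or a factor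
with upper index `j` and lower index in `{1, …, j-1}`. -/
def BasisIdx (ℓ : ℕ) : ℕ → Type
  | 0 => Unit
  | m + 1 => Option (Fin (ℓ + m)) × BasisIdx ℓ m

instance BasisIdx.fintype (ℓ : ℕ) : ∀ m, Fintype (BasisIdx ℓ m)
  | 0 => inferInstanceAs (Fintype Unit)
  | m + 1 =>
    haveI := BasisIdx.fintype ℓ m
    inferInstanceAs (Fintype (Option (Fin (ℓ + m)) × BasisIdx ℓ m))

namespace BasisIdx

/-- The degree of a basis monomial. -/
def deg {ℓ : ℕ} : ∀ {m : ℕ}, BasisIdx ℓ m → ℕ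
  | 0, _ => 0
  | _ + 1, (none, h) => deg h
  | _ + 1, (some _, h) => deg h + 1

/-- The basis monomial, formed from the family `X`. -/
def mon {ℓ : ℕ} {R : Type*} [Monoid R] (X : ℕ → ℕ → R) : ∀ {m : ℕ}, BasisIdx ℓ m → R
  | 0, _ => 1
  | _ + 1, (none, h) => mon X h
  | m + 1, (some p, h) => mon X h * X (p + 1) (ℓ + m + 1)

theorem map_mon {ℓ : ℕ} {R S F : Type*} [Monoid R] [Monoid S] [FunLike F R S]
    [MonoidHomClass F R S] (f : F) (X : ℕ → ℕ → R) :
    ∀ {m : ℕ} (g : BasisIdx ℓ m), f (mon X g) = mon (fun i j => f (X i j)) g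
  | 0, _ => map_one f
  | _ + 1, (none, h) => map_mon f X h
  | _ + 1, (some _, h) => by simp only [mon, map_mul, map_mon f X h]

theorem card_deg (ℓ m : ℕ) : ∀ q : ℕ, Fintype.card {g : BasisIdx ℓ m // deg g = q}
    = ∑ J ∈ (Finset.Icc (ℓ + 1) (ℓ + m)).powersetCard q, ∏ j ∈ J, (j - 1) := by
  simp only [Fintype.card_subtype, Finset.card_filter]
  induction m with
  | zero =>
    intro q
    rw [Finset.Icc_eq_empty (by omega)]
    change ∑ _ : Unit, _ = _
    cases q with
    | zero => simp [deg]
    | succ q =>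
      rw [Finset.powersetCard_eq_empty.2 (by simp)]
      simp [deg]
  | succ m ih =>
    intro q
    have hins : Finset.Icc (ℓ + 1) (ℓ + (m + 1))
        = insert (ℓ + m + 1) (Finset.Icc (ℓ + 1) (ℓ + m)) := by
      ext x; simp only [Finset.mem_Icc, Finset.mem_insert]; omega
    have hnot : ℓ + m + 1 ∉ Finset.Icc (ℓ + 1) (ℓ + m) := by simp
    have hsplit : (∑ g : BasisIdx ℓ (m + 1), if deg g = q then 1 else 0)
        = (∑ h : BasisIdx ℓ m, if deg h = q then 1 else 0)
          + ∑ _p : Fin (ℓ + m), ∑ h : BasisIdx ℓ m, if deg h + 1 = q then 1 else 0 := by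
      change ∑ g : Option (Fin (ℓ + m)) × BasisIdx ℓ m, _ = _
      rw [Fintype.sum_prod_type, Fintype.sum_option]
      rfl
    rw [hsplit, hins]
    cases q with
    | zero => simp [ih]
    | succ q =>
      have hdisj : Disjoint ((Finset.Icc (ℓ + 1) (ℓ + m)).powersetCard (q + 1))
          (((Finset.Icc (ℓ + 1) (ℓ + m)).powersetCard q).image (insert (ℓ + m + 1))) := by
        rw [Finset.disjoint_left]
        intro J hJ hJ'
        obtain ⟨K, -, rfl⟩ := Finset.mem_image.1 hJ'
        exact hnot ((Finset.mem_powersetCard.1 hJ).1 (Finset.mem_insert_self _ _))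
      have hnotmem : ∀ J ∈ (Finset.Icc (ℓ + 1) (ℓ + m)).powersetCard q, ℓ + m + 1 ∉ J :=
        fun J hJ h => hnot ((Finset.mem_powersetCard.1 hJ).1 h)
      rw [Finset.powersetCard_succ_insert hnot, Finset.sum_union hdisj, Finset.sum_image]
      · simp only [Nat.add_right_cancel_iff, Finset.sum_const, Finset.card_univ, Fintype.card_fin,
          ih, smul_eq_mul, Finset.mul_sum]
        congr 1
        refine Finset.sum_congr rfl fun J hJ => ?_
        rw [Finset.prod_insert (hnotmem J hJ), Nat.add_sub_cancel]
      · intro J hJ K hK h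
        rw [← Finset.erase_insert (hnotmem J hJ), h, Finset.erase_insert (hnotmem K hK)]

end BasisIdx

section Spanning

variable {ℓ n : ℕ} {R : Type*} [Ring R] [Algebra ℂ R]

/-- The span of the basis monomials of degree `q` with upper indices at most `ℓ + m`. -/
def monSpan (ℓ : ℕ) (X : ℕ → ℕ → R) (m q : ℕ) : Submodule ℂ R :=
  Submodule.span ℂ (Set.range fun g : {g : BasisIdx ℓ m // g.deg = q} => g.1.mon X)

theorem mon_mem_monSpan (X : ℕ → ℕ → R) {m : ℕ} (g : BasisIdx ℓ m) :
    g.mon X ∈ monSpan ℓ X m g.deg :=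
  Submodule.subset_span ⟨⟨g, rfl⟩, rfl⟩

theorem mul_mem_monSpan {X : ℕ → ℕ → R} {m q q' m' : ℕ} {y : R}
    (H : ∀ g : BasisIdx ℓ m, g.deg = q → g.mon X * y ∈ monSpan ℓ X m' q') {x : R}
    (hx : x ∈ monSpan ℓ X m q) : x * y ∈ monSpan ℓ X m' q' := by
  have : monSpan ℓ X m q ≤ (monSpan ℓ X m' q').comap (LinearMap.mulRight ℂ y) := by
    rw [monSpan, Submodule.span_le]
    rintro _ ⟨⟨g, hg⟩, rfl⟩
    exact H g hg
  exact this hx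

theorem monSpan_le_succ (X : ℕ → ℕ → R) (m q : ℕ) :
    monSpan ℓ X m q ≤ monSpan ℓ X (m + 1) q := by
  intro x hx
  rw [← mul_one x]
  refine mul_mem_monSpan (fun g hg => ?_) hx
  rw [mul_one, ← hg]
  exact mon_mem_monSpan (m := m + 1) X (none, g)

theorem mul_top_mem_monSpan (X : ℕ → ℕ → R) {m q p : ℕ} (hp : 1 ≤ p) (hpm : p ≤ ℓ + m) {x : R}
    (hx : x ∈ monSpan ℓ X m q) : x * X p (ℓ + m + 1) ∈ monSpan ℓ X (m + 1) (q + 1) := by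
  refine mul_mem_monSpan (fun g hg => ?_) hx
  have := mon_mem_monSpan (m := m + 1) X (some ⟨p - 1, by omega⟩, g)
  simpa only [BasisIdx.mon, BasisIdx.deg, hg, Nat.sub_add_cancel hp] using this

theorem IsArnold.mon_mul_mem_monSpan {X : ℕ → ℕ → R} (hX : IsArnold ℓ n X) :
    ∀ {m : ℕ} (g : BasisIdx ℓ m) (i j : ℕ), i ≤ ℓ + m → j ≤ ℓ + m →
      g.mon X * X i j ∈ monSpan ℓ X m (g.deg + 1)
  | 0, g, i, j, hi, hj => by
    rw [hX.low i j hi hj, mul_zero]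
    exact zero_mem _
  | m + 1, g, i, j, hi, hj => by
    have top : ∀ i, i ≤ ℓ + m →
        g.mon X * X i (ℓ + m + 1) ∈ monSpan ℓ X (m + 1) (g.deg + 1) := by
      intro i hi
      rcases Nat.eq_zero_or_pos i with rfl | hi0
      · rw [hX.symm, hX.zero_right, mul_zero]
        exact zero_mem _
      · match g with
        | (none, h) => exact mul_top_mem_monSpan X hi0 hi (mon_mem_monSpan X h)
        | (some p, h) =>
          have hp : (p : ℕ) + 1 ≤ ℓ + m := by omega
          have key : X (p + 1) (ℓ + m + 1) * X i (ℓ + m + 1)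
              = X i (p + 1) * X i (ℓ + m + 1) - X i (p + 1) * X (p + 1) (ℓ + m + 1) := by
            have h1 := hX.arnold (p + 1) (ℓ + m + 1) i
            rw [hX.symm (ℓ + m + 1) i, hX.anticomm i (ℓ + m + 1) i (p + 1)] at h1
            rw [← sub_eq_zero, ← h1]
            abel
          have hmem := hX.mon_mul_mem_monSpan h i (p + 1) hi hp
          simp only [BasisIdx.mon, BasisIdx.deg]
          rw [mul_assoc, key, mul_sub, ← mul_assoc, ← mul_assoc]
          exact sub_mem (mul_top_mem_monSpan X hi0 hi hmem)
            (mul_top_mem_monSpan X (Nat.succ_pos p) hp hmem)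
    rcases Nat.lt_or_ge (ℓ + m) j with hj' | hj'
    · obtain rfl : j = ℓ + m + 1 := by omega
      rcases Nat.lt_or_ge (ℓ + m) i with hi' | hi'
      · obtain rfl : i = ℓ + m + 1 := by omega
        rw [hX.diag, mul_zero]
        exact zero_mem _
      · exact top i hi'
    · rcases Nat.lt_or_ge (ℓ + m) i with hi' | hi'
      · obtain rfl : i = ℓ + m + 1 := by omega
        rw [hX.symm]
        exact top j hj'
      · match g with
        | (none, h) => exact monSpan_le_succ X m _ (hX.mon_mul_mem_monSpan h i j hi' hj')
        | (some p, h) =>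
          simp only [BasisIdx.mon, BasisIdx.deg]
          rw [mul_assoc, hX.anticomm, mul_neg, ← mul_assoc]
          exact neg_mem (mul_top_mem_monSpan X (Nat.succ_pos p) (by omega)
            (hX.mon_mul_mem_monSpan h i j hi' hj'))

theorem IsArnold.span_pow_le_monSpan {m : ℕ} {X : ℕ → ℕ → R} (hX : IsArnold ℓ (ℓ + m) X) (q : ℕ) :
    Submodule.span ℂ (Set.range fun p : ℕ × ℕ => X p.1 p.2) ^ q ≤ monSpan ℓ X m q := by
  induction q with
  | zero =>
    rw [pow_zero, Submodule.one_le]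
    clear hX
    induction m with
    | zero => exact mon_mem_monSpan (m := 0) X ()
    | succ m ih => exact monSpan_le_succ X m 0 ih
  | succ q ih =>
    rw [pow_succ, Submodule.mul_le]
    intro x hx y hy
    have hle : Submodule.span ℂ (Set.range fun p : ℕ × ℕ => X p.1 p.2)
        ≤ (monSpan ℓ X m (q + 1)).comap (LinearMap.mulLeft ℂ x) := by
      rw [Submodule.span_le]
      rintro _ ⟨⟨i, j⟩, rfl⟩
      change x * X i j ∈ monSpan ℓ X m (q + 1)
      rcases Nat.lt_or_ge (ℓ + m) j with hj | hj
      · rw [hX.high i j hj, mul_zero]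
        exact zero_mem _
      rcases Nat.lt_or_ge (ℓ + m) i with hi | hi
      · rw [hX.symm, hX.high j i hi, mul_zero]
        exact zero_mem _
      refine mul_mem_monSpan (fun g hg => ?_) (ih hx)
      rw [← hg]
      exact hX.mon_mul_mem_monSpan g i j hi hj
    exact hle hy

theorem mon_mem_span_pow (X : ℕ → ℕ → R) :
    ∀ {m : ℕ} (g : BasisIdx ℓ m),
      g.mon X ∈ Submodule.span ℂ (Set.range fun p : ℕ × ℕ => X p.1 p.2) ^ g.deg
  | 0, _ => Submodule.one_le.1 le_rfl
  | _ + 1, (none, h) => mon_mem_span_pow X h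
  | m + 1, (some p, h) => by
    simp only [BasisIdx.mon, BasisIdx.deg, pow_succ]
    exact Submodule.mul_mem_mul (mon_mem_span_pow X h)
      (Submodule.subset_span ⟨((p : ℕ) + 1, ℓ + m + 1), rfl⟩)

theorem IsArnold.span_pow_eq_monSpan {m : ℕ} {X : ℕ → ℕ → R} (hX : IsArnold ℓ (ℓ + m) X) (q : ℕ) :
    Submodule.span ℂ (Set.range fun p : ℕ × ℕ => X p.1 p.2) ^ q = monSpan ℓ X m q := by
  refine le_antisymm (hX.span_pow_le_monSpan q) ?_
  rw [monSpan, Submodule.span_le]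
  rintro _ ⟨⟨g, rfl⟩, rfl⟩
  exact mon_mem_span_pow X g

end Spanning

section Representation

variable {V : Type*} [AddCommGroup V] [Module ℂ V]

/-- The operator of left multiplication by `a_{i,k}` on `V ⊗ ⟨1, a_{1,k}, …, a_{k-1,k}⟩`, where
`1` is indexed by `0`. -/
noncomputable def topOp (σ : Module.End ℂ V) (X : ℕ → ℕ → Module.End ℂ V) (i : ℕ) :
    Module.End ℂ (ℕ →₀ V) :=
  Finsupp.lsum ℂ fun m =>
    if m = 0 then Finsupp.lsingle i ∘ₗ σ
    else (Finsupp.lsingle m - Finsupp.lsingle i) ∘ₗ X i m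

/-- The operator of left multiplication by `a_{i,j}` on `V ⊗ ⟨1, a_{1,k}, …, a_{k-1,k}⟩`. -/
noncomputable def extendOp (k : ℕ) (σ : Module.End ℂ V) (X : ℕ → ℕ → Module.End ℂ V) (i j : ℕ) :
    Module.End ℂ (ℕ →₀ V) :=
  if j = k then (if 1 ≤ i ∧ i < k then topOp σ X i else 0)
  else if i = k then (if 1 ≤ j ∧ j < k then topOp σ X j else 0)
  else Finsupp.mapRange.linearMap (X i j)

/-- The sign operator of the grading on `V ⊗ ⟨1, a_{1,k}, …, a_{k-1,k}⟩`. -/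
noncomputable def extendSign (σ : Module.End ℂ V) : Module.End ℂ (ℕ →₀ V) :=
  Finsupp.lsum ℂ fun m => if m = 0 then Finsupp.lsingle 0 ∘ₗ σ else -(Finsupp.lsingle m ∘ₗ σ)

variable {σ : Module.End ℂ V} {X : ℕ → ℕ → Module.End ℂ V}

theorem topOp_single_zero (i : ℕ) (v : V) :
    topOp σ X i (Finsupp.single 0 v) = Finsupp.single i (σ v) := by
  simp [topOp]

theorem topOp_single {i m : ℕ} (hm : m ≠ 0) (v : V) :
    topOp σ X i (Finsupp.single m v) = Finsupp.single m (X i m v) - Finsupp.single i (X i m v) := by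
  simp [topOp, hm]

theorem extendSign_single_zero (v : V) :
    extendSign σ (Finsupp.single 0 v) = Finsupp.single 0 (σ v) := by
  simp [extendSign]

theorem extendSign_single {m : ℕ} (hm : m ≠ 0) (v : V) :
    extendSign σ (Finsupp.single m v) = -Finsupp.single m (σ v) := by
  simp [extendSign, hm]

theorem mapRange_linearMap_zero :
    Finsupp.mapRange.linearMap (0 : Module.End ℂ V) = (0 : Module.End ℂ (ℕ →₀ V)) := by
  ext
  simp

theorem mapRange_linearMap_single (f : Module.End ℂ V) (m : ℕ) (v : V) :
    Finsupp.mapRange.linearMap f (Finsupp.single m v) = Finsupp.single m (f v) := by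
  simp

theorem eq_zero_of_eq_neg {x : V} (h : x = -x) : x = 0 := by
  have h2 : (2 : ℂ) • x = 0 := by
    rw [two_smul]
    exact add_eq_zero_iff_eq_neg.2 h
  exact (smul_eq_zero.1 h2).resolve_left two_ne_zero

theorem End_ext_single {f g : Module.End ℂ (ℕ →₀ V)}
    (h0 : ∀ v, f (Finsupp.single 0 v) = g (Finsupp.single 0 v))
    (h : ∀ m, m ≠ 0 → ∀ v, f (Finsupp.single m v) = g (Finsupp.single m v)) : f = g := by
  refine Finsupp.lhom_ext fun m v => ?_
  rcases eq_or_ne m 0 with rfl | hm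
  exacts [h0 v, h m hm v]

variable {ℓ n : ℕ}

theorem IsArnold.anticomm_apply (hX : IsArnold ℓ n X) (i j k l : ℕ) (v : V) :
    X i j (X k l v) = -X k l (X i j v) :=
  LinearMap.congr_fun (hX.anticomm i j k l) v

theorem IsArnold.arnold_apply (hX : IsArnold ℓ n X) (i j k : ℕ) (v : V) :
    X i j (X j k v) + X j k (X k i v) + X k i (X i j v) = 0 :=
  LinearMap.congr_fun (hX.arnold i j k) v

theorem IsArnold.topOp_anticomm (hX : IsArnold ℓ n X) {i p : ℕ} (hi : i ≠ 0) (hp : p ≠ 0) :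
    topOp σ X i * topOp σ X p = -(topOp σ X p * topOp σ X i) := by
  refine End_ext_single (fun v => ?_) fun m hm v => ?_
  · simp only [Module.End.mul_apply, LinearMap.neg_apply, topOp_single_zero, topOp_single hi,
      topOp_single hp, hX.symm p i]
    abel
  · have h := hX.arnold_apply i p m v
    have hi' := congrArg (Finsupp.single i) h
    have hp' := congrArg (Finsupp.single p) h
    rw [hX.symm m i, hX.anticomm_apply p m i m] at hi' hp'
    simp only [Finsupp.single_add, Finsupp.single_neg, Finsupp.single_zero] at hi' hp'
    simp only [Module.End.mul_apply, LinearMap.neg_apply, topOp_single hm, topOp_single hi,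
      topOp_single hp, hX.symm p i, map_sub, hX.anticomm_apply p m i m,
      hX.anticomm_apply i m i p, Finsupp.single_neg] at hi' hp' ⊢
    linear_combination (norm := module) hi' - hp'

theorem IsArnold.topOp_anticomm_mapRange (hX : IsArnold ℓ n X)
    (hσ : ∀ i j v, σ (X i j v) = -X i j (σ v)) (i j p : ℕ) :
    topOp σ X p * Finsupp.mapRange.linearMap (X i j)
      = -(Finsupp.mapRange.linearMap (X i j) * topOp σ X p) := by
  refine End_ext_single (fun v => ?_) fun m hm v => ?_
  · simp [topOp_single_zero, hσ]
  · simp only [Module.End.mul_apply, LinearMap.neg_apply, topOp_single hm, map_sub,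
      mapRange_linearMap_single, hX.anticomm_apply p m i j, Finsupp.single_neg]
    abel

theorem IsArnold.topOp_arnold (hX : IsArnold ℓ n X)
    (hσ : ∀ i j v, σ (X i j v) = -X i j (σ v)) {i : ℕ} (hi : i ≠ 0) (j : ℕ) :
    Finsupp.mapRange.linearMap (X i j) * topOp σ X j + topOp σ X j * topOp σ X i
      + topOp σ X i * Finsupp.mapRange.linearMap (X i j) = 0 := by
  refine End_ext_single (fun v => ?_) fun m hm v => ?_
  · simp only [Module.End.mul_apply, LinearMap.add_apply, LinearMap.zero_apply,
      topOp_single_zero, topOp_single hi, hX.symm j i, hσ, Finsupp.single_neg,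
      mapRange_linearMap_single]
    abel
  · have h := hX.arnold_apply i j m v
    have hm' := congrArg (Finsupp.single m) h
    have hj' := congrArg (Finsupp.single j) h
    rw [hX.symm m i, hX.anticomm_apply j m i m] at hm' hj'
    simp only [Module.End.mul_apply, LinearMap.add_apply, LinearMap.zero_apply,
      topOp_single hm, topOp_single hi, map_sub, hX.symm j i, hX.anticomm_apply j m i m,
      hX.anticomm_apply i m i j, Finsupp.single_neg, Finsupp.single_add, Finsupp.single_zero,
      mapRange_linearMap_single] at hm' hj' ⊢
    linear_combination (norm := module) hm' - hj'

theorem extendSign_topOp (hσ : ∀ i j v, σ (X i j v) = -X i j (σ v)) {i : ℕ} (hi : i ≠ 0) :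
    extendSign σ * topOp σ X i = -(topOp σ X i * extendSign σ) := by
  refine End_ext_single (fun v => ?_) fun m hm v => ?_
  · simp [topOp_single_zero, extendSign_single_zero, extendSign_single hi]
  · simp only [Module.End.mul_apply, LinearMap.neg_apply, topOp_single hm, map_sub, map_neg,
      extendSign_single hm, extendSign_single hi, hσ, Finsupp.single_neg]
    abel

theorem extendSign_mapRange (hσ : ∀ i j v, σ (X i j v) = -X i j (σ v)) (i j : ℕ) :
    extendSign σ * Finsupp.mapRange.linearMap (X i j)
      = -(Finsupp.mapRange.linearMap (X i j) * extendSign σ) := by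
  refine End_ext_single (fun v => ?_) fun m hm v => ?_
  · simp only [Module.End.mul_apply, LinearMap.neg_apply, extendSign_single_zero,
      mapRange_linearMap_single, hσ, Finsupp.single_neg]
  · simp only [Module.End.mul_apply, LinearMap.neg_apply, extendSign_single hm, map_neg,
      mapRange_linearMap_single, hσ, Finsupp.single_neg]

/-- The two shapes of the operators `extendOp k σ X i j`. -/
theorem extendOp_cases (hX : IsArnold ℓ n X) (k i j : ℕ) :
    (∃ p, p ≠ 0 ∧ extendOp k σ X i j = topOp σ X p) ∨
      ∃ p r, extendOp k σ X i j = Finsupp.mapRange.linearMap (X p r) := by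
  have h0 : ∃ p r, (0 : Module.End ℂ (ℕ →₀ V)) = Finsupp.mapRange.linearMap (X p r) := by
    exact ⟨0, 0, by rw [hX.diag, mapRange_linearMap_zero]⟩
  unfold extendOp
  split_ifs with h1 h2 h3 h4
  · exact Or.inl ⟨i, by omega, rfl⟩
  · exact Or.inr h0
  · exact Or.inl ⟨j, by omega, rfl⟩
  · exact Or.inr h0
  · exact Or.inr ⟨i, j, rfl⟩

theorem IsArnold.extendOp_sign (hX : IsArnold ℓ n X)
    (hσ : ∀ i j v, σ (X i j v) = -X i j (σ v)) (k i j : ℕ) :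
    extendSign σ * extendOp k σ X i j = -(extendOp k σ X i j * extendSign σ) := by
  rcases extendOp_cases (σ := σ) hX k i j with ⟨p, hp, h⟩ | ⟨p, r, h⟩ <;> rw [h]
  exacts [extendSign_topOp hσ hp, extendSign_mapRange hσ p r]

theorem IsArnold.extendOp (hX : IsArnold ℓ n X) (hℓ : ℓ ≤ n)
    (hσ : ∀ i j v, σ (X i j v) = -X i j (σ v)) :
    IsArnold ℓ (n + 1) (extendOp (n + 1) σ X) := by
  have symm : ∀ i j, OSDisc.extendOp (n + 1) σ X i j = OSDisc.extendOp (n + 1) σ X j i := by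
    intro i j
    unfold OSDisc.extendOp
    rw [hX.symm i j]
    by_cases hi : i = n + 1 <;> by_cases hj : j = n + 1 <;> simp [hi, hj]
  have anticomm : ∀ i j k l, OSDisc.extendOp (n + 1) σ X i j * OSDisc.extendOp (n + 1) σ X k l
      = -(OSDisc.extendOp (n + 1) σ X k l * OSDisc.extendOp (n + 1) σ X i j) := by
    intro i j k l
    rcases extendOp_cases (σ := σ) hX (n + 1) i j with ⟨p, hp, h⟩ | ⟨p, r, h⟩ <;>
      rcases extendOp_cases (σ := σ) hX (n + 1) k l with ⟨s, hs, h'⟩ | ⟨s, t, h'⟩ <;> rw [h, h']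
    · exact hX.topOp_anticomm hp hs
    · exact hX.topOp_anticomm_mapRange hσ s t p
    · rw [hX.topOp_anticomm_mapRange hσ p r s, neg_neg]
    · ext m v : 2
      simp [hX.anticomm_apply p r s t]
  have diag : ∀ i, OSDisc.extendOp (n + 1) σ X i i = 0 := by
    intro i
    unfold OSDisc.extendOp
    rw [hX.diag, mapRange_linearMap_zero]
    split_ifs <;> first | rfl | omega
  have zero_right : ∀ i, OSDisc.extendOp (n + 1) σ X i 0 = 0 := by
    intro i
    unfold OSDisc.extendOp
    rw [hX.zero_right, mapRange_linearMap_zero, if_neg (Nat.succ_ne_zero n).symm]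
    split_ifs <;> first | rfl | omega
  have top_sq : ∀ i, OSDisc.extendOp (n + 1) σ X i (n + 1)
      * OSDisc.extendOp (n + 1) σ X i (n + 1) = 0 :=
    fun i => eq_zero_of_eq_neg (anticomm i (n + 1) i (n + 1))
  have arnold_top : ∀ i j, OSDisc.extendOp (n + 1) σ X i j * OSDisc.extendOp (n + 1) σ X j (n + 1)
      + OSDisc.extendOp (n + 1) σ X j (n + 1) * OSDisc.extendOp (n + 1) σ X (n + 1) i
      + OSDisc.extendOp (n + 1) σ X (n + 1) i * OSDisc.extendOp (n + 1) σ X i j = 0 := by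
    intro i j
    rw [symm (n + 1) i]
    by_cases hi : i = n + 1
    · subst hi
      rw [diag, symm (n + 1) j, top_sq]
      simp
    by_cases hj : j = n + 1
    · subst hj
      rw [diag, top_sq]
      simp
    by_cases hi' : 1 ≤ i ∧ i < n + 1
    · by_cases hj' : 1 ≤ j ∧ j < n + 1
      · have := hX.topOp_arnold hσ (i := i) (by omega) j
        simpa only [OSDisc.extendOp, if_pos hi', if_pos hj', if_neg hi, if_neg hj, if_true]
          using this
      · have hz : X i j = 0 := by
          rcases Nat.eq_zero_or_pos j with rfl | hj0
          exacts [hX.zero_right i, hX.high i j (by omega)]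
        have h1 : OSDisc.extendOp (n + 1) σ X j (n + 1) = 0 := by
          rw [OSDisc.extendOp, if_pos rfl, if_neg hj']
        have h2 : OSDisc.extendOp (n + 1) σ X i j = 0 := by
          rw [OSDisc.extendOp, if_neg hj, if_neg hi, hz, mapRange_linearMap_zero]
        rw [h1, h2]
        simp
    · have hz : X i j = 0 := by
        rw [hX.symm]
        rcases Nat.eq_zero_or_pos i with rfl | hi0
        exacts [hX.zero_right j, hX.high j i (by omega)]
      have h1 : OSDisc.extendOp (n + 1) σ X i (n + 1) = 0 := by
        rw [OSDisc.extendOp, if_pos rfl, if_neg hi']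
      have h2 : OSDisc.extendOp (n + 1) σ X i j = 0 := by
        rw [OSDisc.extendOp, if_neg hj, if_neg hi, hz, mapRange_linearMap_zero]
      rw [h1, h2]
      simp
  refine ⟨symm, zero_right, fun i j hj => ?_, fun i j hi hj => ?_, diag, anticomm,
    fun i j k => ?_⟩
  · unfold OSDisc.extendOp
    rw [hX.high i j (by omega), mapRange_linearMap_zero]
    split_ifs <;> first | rfl | omega
  · unfold OSDisc.extendOp
    rw [hX.low i j hi hj, mapRange_linearMap_zero]
    split_ifs <;> first | rfl | omega
  · by_cases hk : k = n + 1
    · subst hk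
      exact arnold_top i j
    by_cases hj : j = n + 1
    · subst hj
      rw [← arnold_top k i]
      abel
    by_cases hi : i = n + 1
    · subst hi
      rw [← arnold_top j k]
      abel
    simp only [OSDisc.extendOp, if_neg hi, if_neg hj, if_neg hk]
    ext m v : 2
    simp [← Finsupp.single_add, hX.arnold_apply i j k]

theorem BasisIdx.mon_extendOp_single (k : ℕ) :
    ∀ {m : ℕ} (_ : ℓ + m < k) (g : BasisIdx ℓ m) (i : ℕ) (v : V),
      g.mon (OSDisc.extendOp k σ X) (Finsupp.single i v) = Finsupp.single i (g.mon X v)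
  | 0, _, _, _, _ => rfl
  | _ + 1, hm, (none, h), i, v => mon_extendOp_single k (by omega) h i v
  | m + 1, hm, (some p, h), i, v => by
    have h1 : ℓ + m + 1 ≠ k := by omega
    have h2 : (p : ℕ) + 1 ≠ k := by omega
    simp only [mon, Module.End.mul_apply]
    rw [← mon_extendOp_single k (by omega) h]
    simp [OSDisc.extendOp, h1, h2]

end Representation

theorem exists_isArnold_linearIndependent (ℓ m : ℕ) :
    ∃ (V : Type) (_ : AddCommGroup V) (_ : Module ℂ V) (σ : Module.End ℂ V)
      (X : ℕ → ℕ → Module.End ℂ V) (v₀ : V), IsArnold ℓ (ℓ + m) X ∧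
        (∀ i j v, σ (X i j v) = -X i j (σ v)) ∧ σ v₀ = v₀ ∧
        LinearIndependent ℂ fun g : BasisIdx ℓ m => g.mon X v₀ := by
  induction m with
  | zero =>
    refine ⟨ℂ, inferInstance, inferInstance, 1, 0, 1, ?_, by simp, rfl, ?_⟩
    · constructor <;> simp
    · change LinearIndependent ℂ fun _ : Unit => (1 : ℂ)
      exact LinearIndependent.of_subsingleton () one_ne_zero
  | succ m ih =>
    obtain ⟨V, _, _, σ, X, v₀, hX, hσ, hv₀, hind⟩ := ih
    refine ⟨ℕ →₀ V, Finsupp.instAddCommGroup, Finsupp.module _ _, extendSign σ, extendOp (ℓ + m + 1) σ X,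
      Finsupp.single 0 v₀, hX.extendOp (Nat.le_add_right _ _) hσ,
      fun i j v => LinearMap.congr_fun (hX.extendOp_sign hσ (ℓ + m + 1) i j) v, ?_, ?_⟩
    · rw [extendSign_single_zero, hv₀]
    · have hall := Finsupp.linearIndependent_single (ι := ℕ) (fun _ => fun g : BasisIdx ℓ m =>
        g.mon X v₀) fun _ => hind
      let e : BasisIdx ℓ (m + 1) → Σ _ : ℕ, BasisIdx ℓ m :=
        fun g => ⟨g.1.elim 0 fun p => (p : ℕ) + 1, g.2⟩
      have he : Function.Injective e := by
        rintro ⟨c, h⟩ ⟨c', h'⟩ heq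
        simp only [e, Sigma.mk.injEq, heq_eq_eq] at heq
        obtain ⟨hc, rfl⟩ := heq
        rcases c with _ | c <;> rcases c' with _ | c'
        · rfl
        · simp at hc
        · simp at hc
        · obtain rfl : c = c' := Fin.ext (by simpa using hc)
          rfl
      have hmon : ∀ g : BasisIdx ℓ (m + 1),
          g.mon (extendOp (ℓ + m + 1) σ X) (Finsupp.single 0 v₀)
            = Finsupp.single (e g).1 ((e g).2.mon X v₀) := by
        rintro ⟨_ | p, h⟩
        · exact BasisIdx.mon_extendOp_single _ (Nat.lt_succ_self _) h 0 v₀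
        · have hp : (p : ℕ) + 1 < ℓ + m + 1 := by omega
          change h.mon (extendOp (ℓ + m + 1) σ X)
              (extendOp (ℓ + m + 1) σ X (p + 1) (ℓ + m + 1) (Finsupp.single 0 v₀))
            = Finsupp.single ((p : ℕ) + 1) (h.mon X v₀)
          rw [← BasisIdx.mon_extendOp_single _ (Nat.lt_succ_self _) h, extendOp, if_pos rfl,
            if_pos ⟨Nat.le_add_left _ _, hp⟩, topOp_single_zero, hv₀]
      rw [funext hmon]
      exact hall.comp e he

section OrlikSolomon

variable {ℓ n : ℕ}

/-- The generators of `A`, symmetric in the two indices. -/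
noncomputable def symGen (ℓ n i j : ℕ) : A ℓ n := a ℓ n (min i j) (max i j)

theorem gen_eq_ι (ℓ n i j : ℕ) : ∃ x, gen ℓ n i j = ExteriorAlgebra.ι ℂ x := by
  unfold gen
  split_ifs
  exacts [⟨_, rfl⟩, ⟨0, (map_zero _).symm⟩]

theorem a_eq_zero {i j : ℕ} (h : ¬(1 ≤ i ∧ i < j ∧ ℓ + 1 ≤ j ∧ j ≤ n)) : a ℓ n i j = 0 := by
  rw [a, gen, dif_neg h, map_zero]

theorem projA_eq_zero {x : E ℓ n} (h : rel ℓ n x 0) : projA ℓ n x = 0 := by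
  rw [projA, RingQuot.mkAlgHom_rel ℂ h, map_zero]

theorem a_arnold {i j k : ℕ} (hij : i < j) (hjk : j < k) :
    a ℓ n i j * a ℓ n i k - a ℓ n i j * a ℓ n j k + a ℓ n i k * a ℓ n j k = 0 := by
  by_cases hi : 1 ≤ i
  swap
  · rw [a_eq_zero (i := i) (j := j) (by omega), a_eq_zero (i := i) (j := k) (by omega)]
    simp
  by_cases hk : k ≤ n
  swap
  · rw [a_eq_zero (i := i) (j := k) (by omega), a_eq_zero (i := j) (j := k) (by omega)]
    simp
  by_cases hj : ℓ + 1 ≤ j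
  · simpa [a] using projA_eq_zero ⟨rfl, Or.inl ⟨i, j, k, hi, hij, hjk, hk, hj, rfl⟩⟩
  · rw [a_eq_zero (i := i) (j := j) (by omega)]
    by_cases hk' : ℓ < k
    · simpa [a] using projA_eq_zero ⟨rfl, Or.inr ⟨i, j, k, hi, hij, by omega, hk', hk, rfl⟩⟩
    · rw [a_eq_zero (i := i) (j := k) (by omega)]
      simp

theorem symGen_of_lt {i j : ℕ} (h : i < j) : symGen ℓ n i j = a ℓ n i j := by
  rw [symGen, min_eq_left h.le, max_eq_right h.le]

theorem isArnold_symGen (ℓ n : ℕ) : IsArnold ℓ n (symGen ℓ n) := by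
  have symm : ∀ i j, symGen ℓ n i j = symGen ℓ n j i := fun i j => by
    rw [symGen, symGen, min_comm, max_comm]
  have diag : ∀ i, symGen ℓ n i i = 0 := fun i => a_eq_zero (by simp)
  have sq : ∀ i j, symGen ℓ n i j * symGen ℓ n i j = 0 := fun i j => a_mul_self _ _
  have anti : ∀ i j k l, symGen ℓ n i j * symGen ℓ n k l
    = -(symGen ℓ n k l * symGen ℓ n i j) := fun i j k l => a_anticomm _ _ _ _
  have sorted : ∀ i j k, i < j → j < k → symGen ℓ n i j * symGen ℓ n j k
      + symGen ℓ n j k * symGen ℓ n i k + symGen ℓ n i k * symGen ℓ n i j = 0 := by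
    intro i j k hij hjk
    have h := a_arnold (ℓ := ℓ) (n := n) hij hjk
    rw [← symGen_of_lt hij, ← symGen_of_lt hjk, ← symGen_of_lt (hij.trans hjk),
      anti i k j k, anti i j i k] at h
    rw [← neg_eq_zero, ← h]
    abel
  have flip : ∀ i j k, symGen ℓ n i j * symGen ℓ n j k + symGen ℓ n j k * symGen ℓ n i k
      + symGen ℓ n i k * symGen ℓ n i j = 0 → symGen ℓ n j k * symGen ℓ n i j
      + symGen ℓ n i k * symGen ℓ n j k + symGen ℓ n i j * symGen ℓ n i k = 0 := by
    intro i j k h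
    rw [anti j k i j, anti i k j k, anti i j i k, ← neg_eq_zero, ← h]
    abel
  refine ⟨symm, fun i => a_eq_zero (by omega), fun i j hj => a_eq_zero (by omega),
    fun i j hi hj => a_eq_zero (by omega), diag, anti, fun i j k => ?_⟩
  rw [symm k i]
  rcases lt_trichotomy i j with hij | rfl | hij
  · rcases lt_trichotomy j k with hjk | rfl | hjk
    · exact sorted i j k hij hjk
    · simp [diag, sq]
    · rcases lt_trichotomy i k with hik | rfl | hik
      · have := flip _ _ _ (sorted i k j hik hjk)
        rw [symm k j] at this
        rw [← this]
        abel
      · simp [diag, symm j i, sq]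
      · have := sorted k i j hik hij
        rw [symm k i, symm k j] at this
        rw [← this]
        abel
  · simp [diag, sq]
  · rcases lt_trichotomy j k with hjk | rfl | hjk
    · rcases lt_trichotomy i k with hik | rfl | hik
      · have := flip _ _ _ (sorted j i k hij hik)
        rw [symm j i] at this
        rw [← this]
        abel
      · simp [diag, symm j i, sq]
      · have := sorted j k i hjk hik
        rw [symm k i, symm j i] at this
        rw [← this]
        abel
    · simp [diag, sq]
    · have := flip _ _ _ (sorted k j i hjk hij)
      rw [symm k j, symm j i, symm k i] at this
      rw [← this]
      abel

theorem map_range_ι (ℓ n : ℕ) :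
    (LinearMap.range (ExteriorAlgebra.ι ℂ : (Idx ℓ n →₀ ℂ) →ₗ[ℂ] E ℓ n)).map
        (projA ℓ n).toLinearMap
      = Submodule.span ℂ (Set.range fun p : ℕ × ℕ => symGen ℓ n p.1 p.2) := by
  apply le_antisymm
  · rintro _ ⟨_, ⟨x, rfl⟩, rfl⟩
    induction x using Finsupp.induction_linear with
    | zero => simp
    | add x y hx hy =>
      rw [map_add, map_add]
      exact add_mem hx hy
    | single p c =>
      have hp : projA ℓ n (ExteriorAlgebra.ι ℂ (Finsupp.single p 1)) = symGen ℓ n p.1.1 p.1.2 := by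
        rw [symGen_of_lt p.2.2.1, a, gen, dif_pos p.2]
        rfl
      rw [← mul_one c, ← smul_eq_mul, ← Finsupp.smul_single, map_smul, map_smul,
        AlgHom.toLinearMap_apply, hp]
      exact Submodule.smul_mem _ _ (Submodule.subset_span ⟨p.1, rfl⟩)
  · rw [Submodule.span_le]
    rintro _ ⟨⟨i, j⟩, rfl⟩
    obtain ⟨x, hx⟩ := gen_eq_ι ℓ n (min i j) (max i j)
    exact ⟨_, ⟨x, hx.symm⟩, rfl⟩

theorem Adeg_eq (ℓ n q : ℕ) :
    Adeg ℓ n q = Submodule.span ℂ (Set.range fun p : ℕ × ℕ => symGen ℓ n p.1 p.2) ^ q := by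
  rw [Adeg, Edeg, Submodule.map_pow, map_range_ι]

/-- The universal property of `A`. -/
theorem IsArnold.exists_algHom {R : Type*} [Ring R] [Algebra ℂ R] {X : ℕ → ℕ → R}
    (hX : IsArnold ℓ n X) :
    ∃ φ : A ℓ n →ₐ[ℂ] R, ∀ i j, φ (symGen ℓ n i j) = X i j := by
  let f : (Idx ℓ n →₀ ℂ) →ₗ[ℂ] R := Finsupp.linearCombination ℂ fun p : Idx ℓ n => X p.1.1 p.1.2
  have hanti : ∀ v w, f v * f w = -(f w * f v) := by
    intro v w
    induction v using Finsupp.induction_linear with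
    | zero => simp
    | add x y hx hy => rw [map_add, add_mul, mul_add, hx, hy, neg_add]
    | single p c =>
      induction w using Finsupp.induction_linear with
      | zero => simp
      | add x y hx hy => rw [map_add, add_mul, mul_add, hx, hy, neg_add]
      | single p' c' =>
        rw [Finsupp.linearCombination_single, Finsupp.linearCombination_single, smul_mul_smul_comm,
          smul_mul_smul_comm, hX.anticomm, smul_neg, mul_comm]
  have hf : ∀ v, f v * f v = 0 := fun v => eq_zero_of_eq_neg (hanti v v)
  have hgen : ∀ i j, i < j → ExteriorAlgebra.lift ℂ ⟨f, hf⟩ (gen ℓ n i j) = X i j := by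
    intro i j hij
    unfold gen
    split_ifs with h
    · rw [ExteriorAlgebra.lift_ι_apply]
      exact (Finsupp.linearCombination_single ..).trans (one_smul _ _)
    · rw [map_zero]
      rcases Nat.eq_zero_or_pos i with rfl | hi
      · rw [hX.symm, hX.zero_right]
      · by_cases hj : j ≤ n
        · rw [hX.low i j (by omega) (by omega)]
        · rw [hX.high i j (by omega)]
  have hrel : ∀ ⦃x y⦄, rel ℓ n x y →
      ExteriorAlgebra.lift ℂ ⟨f, hf⟩ x = ExteriorAlgebra.lift ℂ ⟨f, hf⟩ y := by
    have key : ∀ i j k, X i j * X i k - X i j * X j k + X i k * X j k = 0 := by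
      intro i j k
      have h := hX.arnold i j k
      rw [hX.symm k i, hX.anticomm j k i k, hX.anticomm i k i j] at h
      rw [← neg_eq_zero, ← h]
      abel
    rintro x y ⟨rfl, ⟨i, j, k, hi, hij, hjk, hk, hj, rfl⟩ | ⟨i, j, k, hi, hij, hj, hjk, hk, rfl⟩⟩
    · simp only [map_add, map_sub, map_mul, map_zero, hgen i j hij, hgen j k hjk,
        hgen i k (hij.trans hjk), key]
    · rw [map_mul, map_zero, hgen i k (by omega), hgen j k (by omega), ← key i j k,
        hX.low i j (by omega) hj]
      simp
  refine ⟨RingQuot.liftAlgHom ℂ ⟨_, hrel⟩, fun i j => ?_⟩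
  rcases lt_trichotomy i j with h | rfl | h
  · rw [symGen_of_lt h, a, projA, RingQuot.liftAlgHom_mkAlgHom_apply, hgen i j h]
  · rw [(isArnold_symGen ℓ n).diag, hX.diag, map_zero]
  · rw [(isArnold_symGen ℓ n).symm, hX.symm, symGen_of_lt h, a, projA,
      RingQuot.liftAlgHom_mkAlgHom_apply, hgen j i h]

theorem linearIndependent_mon_symGen (ℓ m : ℕ) :
    LinearIndependent ℂ fun g : BasisIdx ℓ m => g.mon (symGen ℓ (ℓ + m)) := by
  obtain ⟨V, _, _, σ, X, v₀, hX, -, -, hind⟩ := exists_isArnold_linearIndependent ℓ m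
  obtain ⟨φ, hφ⟩ := hX.exists_algHom
  refine LinearIndependent.of_comp (LinearMap.applyₗ v₀ ∘ₗ φ.toLinearMap) ?_
  convert hind using 1
  funext g
  change φ (g.mon (symGen ℓ (ℓ + m))) v₀ = _
  rw [BasisIdx.map_mon]
  simp only [hφ]

end OrlikSolomon

/-- dim_ℂ A^q = Σ_{J ⊆ {ℓ+1,…,n}, |J| = q} ∏_{j ∈ J} (j−1). -/
theorem statement2 (ℓ n : ℕ) (hℓ : 1 ≤ ℓ) (hn : ℓ < n) (q : ℕ) (hq : q ≤ n - ℓ) :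
    Module.finrank ℂ (Adeg ℓ n q)
      = ∑ J ∈ (Finset.Icc (ℓ + 1) n).powersetCard q, ∏ j ∈ J, (j - 1) := by
  obtain ⟨m, rfl⟩ := Nat.exists_eq_add_of_le hn.le
  rw [Adeg_eq, (isArnold_symGen ℓ (ℓ + m)).span_pow_eq_monSpan, ← BasisIdx.card_deg]
  exact finrank_span_eq_card ((linearIndependent_mon_symGen ℓ m).comp _ Subtype.val_injective)

end OSDisc
end
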